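/- (Pohožaev-type identity.) For each M > 0, each ω ∈ S_M, and any constants W > 0 and γ ≥ 0 with ω = 1_{{x ∈ ℝ²₊ : 𝒢[ω](x) − W·x₂ − γ > 0}} a.e. in ℝ²₊, the maximal energy satisfies E(ω) = (3/4)·W·M + (1/2)·γ·‖ω‖₁ (equivalently, I_M = (3/4)WM + (1/2)γ‖ω‖₁). -/

import Mathlib

open MeasureTheory Real Set NNReal Filter Topology

noncomputable section

/-- The upper half plane `ℝ²₊`. -/
def H : Set (ℝ × ℝ) := {p | 0 < p.2}

/-- The half-plane Green function
`G(x,y) = (1/(4π)) log(1 + 4 x₂ y₂ / |x-y|²)` (Euclidean distance). -/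
def G (x y : ℝ × ℝ) : ℝ :=
  (1 / (4 * π)) * Real.log (1 + 4 * x.2 * y.2 / ((x.1 - y.1) ^ 2 + (x.2 - y.2) ^ 2))

/-- The potential `𝒢[ω](x) = ∫_{ℝ²₊} G(x,y) ω(y) dy`. -/
def Gpot (ω : ℝ × ℝ → ℝ) (x : ℝ × ℝ) : ℝ := ∫ y in H, G x y * ω y

/-- The kinetic energy `E(ω) = (1/2) ∫∫ G(x,y) ω(x) ω(y) dy dx`. -/
def energy (ω : ℝ × ℝ → ℝ) : ℝ :=
  (1 / 2) * ∫ x in H, ∫ y in H, G x y * ω x * ω y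

/-- The `L¹(ℝ²₊)` norm (mass). -/
def norm1 (ω : ℝ × ℝ → ℝ) : ℝ := ∫ x in H, |ω x|

/-- The `L²(ℝ²₊)` norm. -/
def norm2 (ω : ℝ × ℝ → ℝ) : ℝ := (∫ x in H, ω x ^ 2) ^ ((1 : ℝ) / 2)

/-- The impulse `‖x₂ ω‖₁ = ∫_{ℝ²₊} x₂ |ω(x)| dx`. -/
def impulse (ω : ℝ × ℝ → ℝ) : ℝ := ∫ x in H, x.2 * |ω x|

/-- `ω ∈ (L¹ ∩ L²)(ℝ²₊)`. -/
def MemL1L2 (ω : ℝ × ℝ → ℝ) : Prop :=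
  Integrable ω (volume.restrict H) ∧ Integrable (fun x => ω x ^ 2) (volume.restrict H)

/-- Finiteness of the impulse `‖x₂ ω‖₁ < ∞`. -/
def ImpulseFinite (ω : ℝ × ℝ → ℝ) : Prop :=
  Integrable (fun x : ℝ × ℝ => x.2 * |ω x|) (volume.restrict H)

/-- The admissible class `K_M`: patches `ω = 1_A` a.e. on `ℝ²₊` with
impulse `∫_A x₂ = M` and mass `|A| ≤ 1`. -/
def memK (M : ℝ) (ω : ℝ × ℝ → ℝ) : Prop :=
  Integrable ω (volume.restrict H) ∧
  ∃ A : Set (ℝ × ℝ), A ⊆ H ∧ MeasurableSet A ∧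
    (∀ᵐ x ∂volume.restrict H, ω x = A.indicator (fun _ => (1 : ℝ)) x) ∧
    (∫ x in A, x.2) = M ∧ volume A ≤ 1

/-- The admissible class `K_{M,∞}`: patches `ω = 1_A` a.e. on `ℝ²₊` with
impulse `∫_A x₂ = M`, without any mass bound. -/
def memKinf (M : ℝ) (ω : ℝ × ℝ → ℝ) : Prop :=
  Integrable ω (volume.restrict H) ∧
  ∃ A : Set (ℝ × ℝ), A ⊆ H ∧ MeasurableSet A ∧
    (∀ᵐ x ∂volume.restrict H, ω x = A.indicator (fun _ => (1 : ℝ)) x) ∧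
    (∫ x in A, x.2) = M

/-- The relaxed admissible class `K̃_M`: measurable `0 ≤ ω ≤ 1` with
mass `≤ 1` and impulse `≤ M`. -/
def memKt (M : ℝ) (ω : ℝ × ℝ → ℝ) : Prop :=
  Integrable ω (volume.restrict H) ∧
  (∀ᵐ x ∂volume.restrict H, 0 ≤ ω x ∧ ω x ≤ 1) ∧
  norm1 ω ≤ 1 ∧
  Integrable (fun x : ℝ × ℝ => x.2 * |ω x|) (volume.restrict H) ∧
  impulse ω ≤ M

/-- The set of maximizers `S_M` of the energy over `K_M`. -/
def memS (M : ℝ) (ω : ℝ × ℝ → ℝ) : Prop :=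
  memK M ω ∧ ∀ ω' : ℝ × ℝ → ℝ, memK M ω' → energy ω' ≤ energy ω

/-- The maximal energy `I_M` over `K_M`. -/
def Isup (M : ℝ) : ℝ := sSup (energy '' {ω | memK M ω})

/-- The maximal energy `I_{1,∞}` over `K_{1,∞}`. -/
def IsupInf : ℝ := sSup (energy '' {ω | memKinf 1 ω})

/-- The Steiner symmetry condition for a set `Ω ⊆ ℝ²₊`. -/
def SteinerSet (Ω : Set (ℝ × ℝ)) : Prop :=
  (∀ x₁ x₂ : ℝ, 0 < x₂ → (((x₁, x₂) : ℝ × ℝ) ∈ Ω ↔ ((-x₁, x₂) : ℝ × ℝ) ∈ Ω)) ∧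
  (∀ x₂ : ℝ, 0 < x₂ → ∀ a b : ℝ, 0 ≤ a → a ≤ b →
    ((b, x₂) : ℝ × ℝ) ∈ Ω → ((a, x₂) : ℝ × ℝ) ∈ Ω)

/-- The Steiner symmetry condition for a nonnegative function on `ℝ²₊`. -/
def SteinerFn (f : ℝ × ℝ → ℝ) : Prop :=
  (∀ x₁ x₂ : ℝ, 0 < x₂ → f (x₁, x₂) = f (-x₁, x₂)) ∧
  (∀ x₂ : ℝ, 0 < x₂ → ∀ a b : ℝ, 0 ≤ a → a ≤ b → f (b, x₂) ≤ f (a, x₂))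


/-- The potential of the patch `A`. -/
def patchPot (A : Set (ℝ × ℝ)) (x : ℝ × ℝ) : ℝ := ∫ y in A, G x y

lemma sq_norm_le_sq_add_sq (z : ℝ × ℝ) : ‖z‖ ^ 2 ≤ z.1 ^ 2 + z.2 ^ 2 := by
  rw [Prod.norm_def]
  rcases max_cases ‖z.1‖ ‖z.2‖ with ⟨h, -⟩ | ⟨h, -⟩ <;> rw [h, Real.norm_eq_abs, sq_abs] <;>
    nlinarith [sq_nonneg z.1, sq_nonneg z.2]

lemma abs_snd_le_norm (z : ℝ × ℝ) : |z.2| ≤ ‖z‖ := norm_snd_le z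

lemma abs_fst_le_norm (z : ℝ × ℝ) : |z.1| ≤ ‖z‖ := norm_fst_le z

lemma green_nonneg {x y : ℝ × ℝ} (hx : x ∈ H) (hy : y ∈ H) : 0 ≤ G x y := by
  have hx' : 0 < x.2 := hx
  have hy' : 0 < y.2 := hy
  unfold G
  have : 0 ≤ Real.log (1 + 4 * x.2 * y.2 / ((x.1 - y.1) ^ 2 + (x.2 - y.2) ^ 2)) := by
    apply Real.log_nonneg
    have : 0 ≤ 4 * x.2 * y.2 / ((x.1 - y.1) ^ 2 + (x.2 - y.2) ^ 2) := by positivity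
    linarith
  positivity

lemma green_le {x y : ℝ × ℝ} (hx : x ∈ H) (hy : y ∈ H) :
    G x y ≤ x.2 / π * ‖x - y‖ ^ (-1 : ℝ) := by
  have hx' : 0 < x.2 := hx
  have hy' : 0 < y.2 := hy
  rw [Real.rpow_neg_one]
  rcases eq_or_ne x y with rfl | hne
  · simp [G]
  have hd : 0 < ‖x - y‖ := norm_pos_iff.2 (sub_ne_zero.2 hne)
  have hD := sq_norm_le_sq_add_sq (x - y)
  have hy2 := abs_snd_le_norm (x - y)
  simp only [Prod.fst_sub, Prod.snd_sub] at hD hy2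
  set d := ‖x - y‖
  have hy3 : y.2 ≤ x.2 + d := by linarith [neg_abs_le (x.2 - y.2)]
  have h1 : 4 * x.2 * y.2 / ((x.1 - y.1) ^ 2 + (x.2 - y.2) ^ 2) ≤
      4 * x.2 * (x.2 + d) / d ^ 2 := by gcongr
  have h2 : 1 + 4 * x.2 * (x.2 + d) / d ^ 2 = (1 + 2 * x.2 / d) ^ 2 := by
    field_simp; ring
  have h3 : Real.log (1 + 4 * x.2 * y.2 / ((x.1 - y.1) ^ 2 + (x.2 - y.2) ^ 2)) ≤
      4 * x.2 / d := by
    calc _ ≤ Real.log ((1 + 2 * x.2 / d) ^ 2) := by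
          apply Real.log_le_log (by positivity)
          linarith
      _ = 2 * Real.log (1 + 2 * x.2 / d) := by rw [Real.log_pow]; norm_num
      _ ≤ 2 * (2 * x.2 / d) := by
          gcongr
          have := Real.log_le_sub_one_of_pos (show 0 < 1 + 2 * x.2 / d by positivity)
          linarith
      _ = _ := by ring
  unfold G
  calc _ ≤ 1 / (4 * π) * (4 * x.2 / d) := by gcongr
    _ = _ := by field_simp

lemma measurable_green : Measurable (Function.uncurry G) := by
  unfold G Function.uncurry
  fun_prop

lemma measurable_green_right (x : ℝ × ℝ) : Measurable (G x) :=
  measurable_green.comp measurable_prodMk_left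

lemma measurable_patchPot (A : Set (ℝ × ℝ)) : Measurable (patchPot A) :=
  (measurable_green.stronglyMeasurable.integral_prod_right).measurable

section Riesz

lemma integrableOn_ball_norm_rpow {α : ℝ} (hα : α < 2) :
    IntegrableOn (fun z : ℝ × ℝ => ‖z‖ ^ (-α)) (Metric.ball 0 1) := by
  refine integrableOn_ball_of_norm_le_rpow (C := 1) (α := α) (by simp) (by simpa using hα)
    (ae_of_all _ fun x => ?_)
    (Measurable.aestronglyMeasurable (by fun_prop))
  rw [Real.norm_of_nonneg (by positivity), one_mul]

variable {α : ℝ} {A : Set (ℝ × ℝ)}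

lemma integrable_riesz_bound (hα' : α < 2) (hA : MeasurableSet A) (hAv : volume A ≠ ⊤)
    (x : ℝ × ℝ) :
    Integrable (fun y => (Metric.ball (0 : ℝ × ℝ) 1).indicator (fun z => ‖z‖ ^ (-α)) (x - y) +
      A.indicator (fun _ => (1 : ℝ)) y) := by
  refine Integrable.add ?_ ((integrable_indicator_iff hA).2 (integrableOn_const hAv))
  exact ((integrable_indicator_iff measurableSet_ball).2
    (integrableOn_ball_norm_rpow hα')).comp_sub_left x

lemma riesz_le_bound (hα : 0 ≤ α) (x : ℝ × ℝ) (y : ℝ × ℝ) :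
    A.indicator (fun y => ‖x - y‖ ^ (-α)) y ≤
    (Metric.ball (0 : ℝ × ℝ) 1).indicator (fun z => ‖z‖ ^ (-α)) (x - y) +
      A.indicator (fun _ => (1 : ℝ)) y := by
  by_cases hy : y ∈ A
  · simp only [hy, indicator_of_mem]
    by_cases h : x - y ∈ Metric.ball (0 : ℝ × ℝ) 1
    · rw [indicator_of_mem h]; linarith
    · rw [indicator_of_notMem h]
      have : 1 ≤ ‖x - y‖ := by simpa using h
      rw [zero_add]
      exact Real.rpow_le_one_of_one_le_of_nonpos this (by linarith)
  · simp only [hy, not_false_eq_true, indicator_of_notMem, add_zero]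
    exact indicator_nonneg (fun z _ => by positivity) _

lemma integrableOn_riesz (hα : 0 ≤ α) (hα' : α < 2) (hA : MeasurableSet A)
    (hAv : volume A ≠ ⊤) (x : ℝ × ℝ) :
    IntegrableOn (fun y => ‖x - y‖ ^ (-α)) A := by
  rw [← integrable_indicator_iff hA]
  refine (integrable_riesz_bound hα' hA hAv x).mono'
    (Measurable.aestronglyMeasurable (Measurable.indicator (by fun_prop) hA))
    (ae_of_all _ fun y => ?_)
  rw [Real.norm_of_nonneg (indicator_nonneg (fun z _ => by positivity) _)]
  exact riesz_le_bound hα x y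

lemma setIntegral_riesz_le (hα : 0 ≤ α) (hα' : α < 2) (hA : MeasurableSet A)
    (hAv : volume A ≠ ⊤) (x : ℝ × ℝ) :
    ∫ y in A, ‖x - y‖ ^ (-α) ≤
      (∫ z in Metric.ball (0 : ℝ × ℝ) 1, ‖z‖ ^ (-α)) + volume.real A := by
  rw [← integral_indicator hA]
  refine (integral_mono ((integrable_indicator_iff hA).2 (integrableOn_riesz hα hα' hA hAv x))
    (integrable_riesz_bound hα' hA hAv x) (riesz_le_bound hα x)).trans_eq ?_
  rw [integral_add]
  · rw [integral_sub_left_eq_self (fun y =>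
      (Metric.ball (0 : ℝ × ℝ) 1).indicator (fun z => ‖z‖ ^ (-α)) y) volume x,
      integral_indicator measurableSet_ball, integral_indicator hA]
    simp
  · exact ((integrable_indicator_iff measurableSet_ball).2
      (integrableOn_ball_norm_rpow hα')).comp_sub_left x
  · exact (integrable_indicator_iff hA).2 (integrableOn_const hAv)

lemma inv_le_add_rpow {d η : ℝ} (hd : 0 < d) (hη : 0 < η) :
    d ^ (-1 : ℝ) ≤ η * d ^ (-(3 / 2) : ℝ) + (η ^ 2)⁻¹ := by
  have h1 : d ^ (-1 : ℝ) = (d ^ (-(1 / 2) : ℝ)) ^ 2 := by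
    rw [← Real.rpow_natCast, ← Real.rpow_mul hd.le]; norm_num
  have h2 : d ^ (-(3 / 2) : ℝ) = (d ^ (-(1 / 2) : ℝ)) ^ 3 := by
    rw [← Real.rpow_natCast, ← Real.rpow_mul hd.le]; norm_num
  rw [h1, h2]
  have hs : 0 < d ^ (-(1 / 2) : ℝ) := by positivity
  set s := d ^ (-(1 / 2) : ℝ)
  rcases le_total 1 (η * s) with h | h
  · have : s ^ 2 * 1 ≤ s ^ 2 * (η * s) := by gcongr
    have : 0 < (η ^ 2)⁻¹ := by positivity
    nlinarith
  · have : s ^ 2 ≤ (η ^ 2)⁻¹ := by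
      rw [← one_div, le_div_iff₀ (by positivity)]
      nlinarith [mul_pos hη hs]
    have : 0 < η * s ^ 3 := by positivity
    linarith

lemma exists_measureReal_diff_closedBall_lt (hA : MeasurableSet A) (hAv : volume A ≠ ⊤)
    {ε : ℝ} (hε : 0 < ε) :
    ∃ N : ℕ, volume.real (A \ Metric.closedBall 0 N) < ε := by
  have h := tendsto_measure_iInter_atTop (μ := (volume : Measure (ℝ × ℝ)))
    (s := fun n : ℕ => A \ Metric.closedBall 0 (n : ℝ))
    (fun n => (hA.diff Metric.isClosed_closedBall.measurableSet).nullMeasurableSet)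
    (fun m n hmn => sdiff_subset_sdiff_right (Metric.closedBall_subset_closedBall (by simpa)))
    ⟨0, measure_ne_top_of_subset sdiff_subset hAv⟩
  have h0 : ⋂ n : ℕ, A \ Metric.closedBall (0 : ℝ × ℝ) (n : ℝ) = ∅ := by
    ext z
    simp only [mem_iInter, Set.mem_sdiff, mem_empty_iff_false, iff_false, not_forall]
    obtain ⟨n, hn⟩ := exists_nat_ge ‖z‖
    exact ⟨n, fun h => h.2 (by simpa using hn)⟩
  rw [h0, measure_empty] at h
  have h' := (ENNReal.tendsto_toReal ENNReal.zero_ne_top).comp h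
  exact (h'.eventually (gt_mem_nhds (by simpa using hε))).exists

lemma exists_setIntegral_riesz_le (hA : MeasurableSet A) (hAv : volume A ≠ ⊤) {ε : ℝ}
    (hε : 0 < ε) :
    ∃ R : ℝ, ∀ x : ℝ × ℝ, R < ‖x‖ → ∫ y in A, ‖x - y‖ ^ (-1 : ℝ) ≤ ε := by
  set C := (∫ z in Metric.ball (0 : ℝ × ℝ) 1, ‖z‖ ^ (-(3 / 2) : ℝ)) + volume.real A with hC
  have hC0 : 0 ≤ C := add_nonneg (integral_nonneg fun y => by positivity) measureReal_nonneg
  set η := ε / (3 * (C + 1)) with hη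
  have hη0 : 0 < η := by positivity
  obtain ⟨N, hN⟩ := exists_measureReal_diff_closedBall_lt hA hAv
    (show 0 < η ^ 2 * (ε / 3) by positivity)
  set m := volume.real A with hm
  have hm0 : 0 ≤ m := measureReal_nonneg
  set K := 3 * (m + 1) / ε with hK
  have hK0 : 0 < K := by positivity
  refine ⟨N + K, fun x hx => ?_⟩
  have hB : MeasurableSet (A \ Metric.closedBall (0 : ℝ × ℝ) N) :=
    hA.diff Metric.isClosed_closedBall.measurableSet
  have hi := integrableOn_riesz (α := 3 / 2) (by norm_num) (by norm_num) hA hAv x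
  have hi3 : IntegrableOn
      (fun y => (A \ Metric.closedBall 0 (N : ℝ)).indicator (fun _ => (η ^ 2)⁻¹) y) A :=
    (integrableOn_const hAv).indicator hB
  have hc : IntegrableOn (fun _ : ℝ × ℝ => K⁻¹) A := integrableOn_const hAv
  have hci : IntegrableOn (fun y => K⁻¹ + η * ‖x - y‖ ^ (-(3 / 2) : ℝ)) A :=
    hc.add (hi.const_mul η)
  have key : ∫ y in A, ‖x - y‖ ^ (-1 : ℝ) ≤ ∫ y in A, (K⁻¹ + η * ‖x - y‖ ^ (-(3 / 2) : ℝ) +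
      (A \ Metric.closedBall 0 (N : ℝ)).indicator (fun _ => (η ^ 2)⁻¹) y) := by
    refine setIntegral_mono_on
      (integrableOn_riesz (α := 1) (by norm_num) (by norm_num) hA hAv x)
      (hci.add hi3) hA fun y hy => ?_
    by_cases hyN : y ∈ Metric.closedBall (0 : ℝ × ℝ) N
    · rw [indicator_of_notMem (by simp_all)]
      have hyN' : ‖y‖ ≤ N := by simpa using hyN
      have : K ≤ ‖x - y‖ := by linarith [norm_sub_norm_le x y]
      have h1 : ‖x - y‖ ^ (-1 : ℝ) ≤ K⁻¹ := by
        rw [Real.rpow_neg_one]; gcongr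
      have : 0 ≤ η * ‖x - y‖ ^ (-(3 / 2) : ℝ) := by positivity
      linarith
    · rw [indicator_of_mem (mem_sdiff_of_mem hy hyN)]
      rcases (norm_nonneg (x - y)).eq_or_lt with h | h
      · rw [← h, Real.zero_rpow (by norm_num), Real.zero_rpow (by norm_num)]; positivity
      · have := inv_le_add_rpow h hη0
        have : 0 < K⁻¹ := by positivity
        linarith
  refine key.trans ?_
  rw [integral_add hci hi3, integral_add hc (hi.const_mul η),
    integral_const_mul, setIntegral_indicator hB, setIntegral_const, setIntegral_const,
    inter_eq_self_of_subset_right sdiff_subset]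
  have h3 := setIntegral_riesz_le (α := 3 / 2) (by norm_num) (by norm_num) hA hAv x
  rw [← hC] at h3
  have e1 : m • K⁻¹ ≤ ε / 3 := by
    rw [smul_eq_mul, hK, inv_div, mul_div_assoc', div_le_div_iff₀ (by positivity) (by norm_num)]
    nlinarith
  have e2 : η * ∫ y in A, ‖x - y‖ ^ (-(3 / 2) : ℝ) ≤ ε / 3 := by
    calc _ ≤ η * C := by gcongr
      _ ≤ ε / 3 := by
        rw [hη, div_mul_eq_mul_div, div_le_div_iff₀ (by positivity) (by norm_num)]
        nlinarith
  have e3 : volume.real (A \ Metric.closedBall 0 (N : ℝ)) • (η ^ 2)⁻¹ ≤ ε / 3 := by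
    rw [smul_eq_mul, ← div_eq_mul_inv, div_le_iff₀ (by positivity)]
    linarith
  linarith

end Riesz

section Patch

open scoped Pointwise

variable {A : Set (ℝ × ℝ)}

lemma integrableOn_green (hA : MeasurableSet A) (hAH : A ⊆ H) (hAv : volume A ≠ ⊤)
    {x : ℝ × ℝ} (hx : x ∈ H) : IntegrableOn (G x) A := by
  refine ((integrableOn_riesz (α := 1) (by norm_num) (by norm_num) hA hAv x).const_mul
    (x.2 / π)).mono' (measurable_green_right x).aestronglyMeasurable ?_
  filter_upwards [ae_restrict_mem hA] with y hy
  rw [Real.norm_of_nonneg (green_nonneg hx (hAH hy))]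
  exact green_le hx (hAH hy)

lemma patchPot_nonneg (hA : MeasurableSet A) (hAH : A ⊆ H) {x : ℝ × ℝ} (hx : x ∈ H) :
    0 ≤ patchPot A x :=
  setIntegral_nonneg hA fun _ hy => green_nonneg hx (hAH hy)

lemma patchPot_le_riesz (hA : MeasurableSet A) (hAH : A ⊆ H) (hAv : volume A ≠ ⊤)
    {x : ℝ × ℝ} (hx : x ∈ H) :
    patchPot A x ≤ x.2 / π * ∫ y in A, ‖x - y‖ ^ (-1 : ℝ) := by
  rw [← integral_const_mul]
  exact setIntegral_mono_on (integrableOn_green hA hAH hAv hx)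
    ((integrableOn_riesz (α := 1) (by norm_num) (by norm_num) hA hAv x).const_mul _) hA
    fun y hy => green_le hx (hAH hy)

lemma exists_patchPot_le (hA : MeasurableSet A) (hAH : A ⊆ H) (hAv : volume A ≠ ⊤) :
    ∃ C, 0 ≤ C ∧ ∀ x ∈ H, patchPot A x ≤ C * x.2 := by
  set C := (∫ z in Metric.ball (0 : ℝ × ℝ) 1, ‖z‖ ^ (-1 : ℝ)) + volume.real A
  have hC0 : 0 ≤ C := add_nonneg (integral_nonneg fun y => by positivity) measureReal_nonneg
  refine ⟨C / π, by positivity, fun x hx => (patchPot_le_riesz hA hAH hAv hx).trans ?_⟩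
  have hx' : 0 < x.2 := hx
  calc _ ≤ x.2 / π * C := by
        gcongr
        exact setIntegral_riesz_le (by norm_num) (by norm_num) hA hAv x
    _ = _ := by ring

lemma exists_patchPot_le_of_norm_gt (hA : MeasurableSet A) (hAH : A ⊆ H)
    (hAv : volume A ≠ ⊤) {W : ℝ} (hW : 0 < W) :
    ∃ R : ℝ, ∀ x ∈ H, R < ‖x‖ → patchPot A x ≤ W * x.2 := by
  obtain ⟨R, hR⟩ := exists_setIntegral_riesz_le hA hAv (show 0 < W * π by positivity)
  refine ⟨R, fun x hx hxR => (patchPot_le_riesz hA hAH hAv hx).trans ?_⟩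
  have hx' : 0 < x.2 := hx
  calc _ ≤ x.2 / π * (W * π) := by gcongr; exact hR x hxR
    _ = _ := by field_simp

lemma smul_mem_H {r : ℝ} (hr : 0 < r) {x : ℝ × ℝ} (hx : x ∈ H) : r • x ∈ H := by
  have hx' : 0 < x.2 := hx
  change 0 < (r • x).2
  simp only [Prod.smul_snd, smul_eq_mul]; positivity

lemma green_smul_left {r : ℝ} (hr : 0 < r) (x y : ℝ × ℝ) : G (r • x) y = G (r⁻¹ • y) x := by
  unfold G
  simp only [Prod.smul_snd, Prod.smul_fst, smul_eq_mul]
  have : (r⁻¹ * y.1 - x.1) ^ 2 + (r⁻¹ * y.2 - x.2) ^ 2 =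
      ((r * x.1 - y.1) ^ 2 + (r * x.2 - y.2) ^ 2) * (r⁻¹) ^ 2 := by field_simp; ring
  rw [this]
  congr 3
  rw [show 4 * (r⁻¹ * y.2) * x.2 = (4 * (r * x.2) * y.2) * (r⁻¹) ^ 2 by field_simp]
  rw [mul_div_mul_right _ _ (by positivity)]

lemma log_one_add_sq_le {u : ℝ} (hu : 0 ≤ u) :
    Real.log (1 + u ^ 2) ≤ 2 * u ^ (3 / 2 : ℝ) := by
  have h1 : (1 + u ^ 2) ^ (3 / 4 : ℝ) ≤ 1 + u ^ (3 / 2 : ℝ) := by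
    refine (Real.rpow_add_le_add_rpow zero_le_one (sq_nonneg u) (by norm_num)
      (by norm_num)).trans_eq ?_
    rw [Real.one_rpow, ← Real.rpow_natCast, ← Real.rpow_mul hu]
    norm_num
  have h2 : 3 / 4 * Real.log (1 + u ^ 2) ≤ u ^ (3 / 2 : ℝ) := by
    rw [← Real.log_rpow (by positivity)]
    refine (Real.log_le_log (by positivity) h1).trans ?_
    have := Real.log_le_sub_one_of_pos (show 0 < 1 + u ^ (3 / 2 : ℝ) by positivity)
    linarith
  have : 0 ≤ u ^ (3 / 2 : ℝ) := by positivity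
  linarith

/-- A quantitative form of the convexity of `D ↦ log (1 + c / D)`. -/
lemma two_log_sub_le {c D D₁ D₂ : ℝ} (hc : 0 ≤ c) (hD : 0 < D) (h₁ : 0 < D₁) (h₂ : 0 < D₂)
    {v : ℝ} (hm : (D₁ + D₂) / 2 ≤ D * (1 + v)) (hv : 0 ≤ v) :
    2 * Real.log (1 + c / D) - Real.log (1 + c / D₁) - Real.log (1 + c / D₂) ≤
      2 * Real.log (1 + v) := by
  set m := (D₁ + D₂) / 2 with hm'
  have hm0 : 0 < m := by positivity
  have a1 : (1 + c / m) ^ 2 ≤ (1 + c / D₁) * (1 + c / D₂) := by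
    have hp : D₁ * D₂ ≤ m ^ 2 := by rw [hm']; nlinarith [sq_nonneg (D₁ - D₂)]
    have e1 : (1 + c / D₁) * (1 + c / D₂) = 1 + (2 * c * m + c ^ 2) / (D₁ * D₂) := by
      rw [hm']; field_simp; ring
    have e2 : (1 + c / m) ^ 2 = 1 + (2 * c * m + c ^ 2) / m ^ 2 := by field_simp; ring
    rw [e1, e2]
    gcongr
  have a2 : 1 + c / D ≤ (1 + c / m) * (1 + v) := by
    have : c / D ≤ c / m * (1 + v) := by
      rw [div_mul_eq_mul_div, div_le_div_iff₀ hD hm0]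
      nlinarith
    nlinarith
  have b1 := Real.log_le_log (by positivity) a1
  have b2 := Real.log_le_log (by positivity) a2
  rw [Real.log_pow, Real.log_mul (by positivity) (by positivity)] at b1
  rw [Real.log_mul (by positivity) (by positivity)] at b2
  push_cast at b1
  linarith

lemma two_green_sub_le {R : ℝ} {x y : ℝ × ℝ} (hx : x ∈ H) (hy : y ∈ H) (hxR : ‖x‖ ≤ R)
    (hyR : ‖y‖ ≤ R) {r : ℝ} (hr : 1 / 2 ≤ r) (hxy : y ≠ x) (hxy₁ : y ≠ r • x)
    (hxy₂ : y ≠ r⁻¹ • x) :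
    2 * G x y - G (r • x) y - G (r⁻¹ • x) y ≤
      (2 * R * |r - 1|) ^ (3 / 2 : ℝ) * ‖x - y‖ ^ (-(3 / 2) : ℝ) := by
  have hx' : 0 < x.2 := hx
  have hy' : 0 < y.2 := hy
  have hr0 : 0 < r := by linarith
  have hR0 : 0 ≤ R := (norm_nonneg x).trans hxR
  have hd : 0 < ‖x - y‖ := norm_pos_iff.2 (sub_ne_zero.2 hxy.symm)
  have sq_pos : ∀ z : ℝ × ℝ, y ≠ z → 0 < (z.1 - y.1) ^ 2 + (z.2 - y.2) ^ 2 := fun z hz => by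
    have := sq_norm_le_sq_add_sq (z - y)
    have h0 : 0 < ‖z - y‖ := norm_pos_iff.2 (sub_ne_zero.2 hz.symm)
    simp only [Prod.fst_sub, Prod.snd_sub] at this
    exact (by positivity : 0 < ‖z - y‖ ^ 2).trans_le this
  have hDd := sq_norm_le_sq_add_sq (x - y)
  simp only [Prod.fst_sub, Prod.snd_sub] at hDd
  have hD := sq_pos x hxy
  have h₁ := sq_pos _ hxy₁
  have h₂ := sq_pos _ hxy₂
  simp only [Prod.smul_snd, Prod.smul_fst, smul_eq_mul] at h₁ h₂
  have g₁ : G (r • x) y = 1 / (4 * π) * Real.log (1 + 4 * x.2 * y.2 /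
      (((r * x.1 - y.1) ^ 2 + (r * x.2 - y.2) ^ 2) / r)) := by
    simp only [G, Prod.smul_snd, Prod.smul_fst, smul_eq_mul]
    congr 3
    field_simp
  have g₂ : G (r⁻¹ • x) y = 1 / (4 * π) * Real.log (1 + 4 * x.2 * y.2 /
      (((r⁻¹ * x.1 - y.1) ^ 2 + (r⁻¹ * x.2 - y.2) ^ 2) * r)) := by
    simp only [G, Prod.smul_snd, Prod.smul_fst, smul_eq_mul]
    congr 3
    rw [← div_div, div_right_comm]
    congr 1
    field_simp
  set u := 2 * R * |r - 1| / ‖x - y‖ with hu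
  have hu0 : 0 ≤ u := by positivity
  have bx1 : x.1 ^ 2 ≤ R ^ 2 := by
    rw [← sq_abs]; gcongr; exact (abs_fst_le_norm x).trans hxR
  have bx2 : x.2 ^ 2 ≤ R ^ 2 := by
    rw [← sq_abs]; gcongr; exact (abs_snd_le_norm x).trans hxR
  have by1 : y.1 ^ 2 ≤ R ^ 2 := by
    rw [← sq_abs]; gcongr; exact (abs_fst_le_norm y).trans hyR
  have by2 : y.2 ^ 2 ≤ R ^ 2 := by
    rw [← sq_abs]; gcongr; exact (abs_snd_le_norm y).trans hyR
  have hm : (((r * x.1 - y.1) ^ 2 + (r * x.2 - y.2) ^ 2) / r +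
      ((r⁻¹ * x.1 - y.1) ^ 2 + (r⁻¹ * x.2 - y.2) ^ 2) * r) / 2 ≤
      ((x.1 - y.1) ^ 2 + (x.2 - y.2) ^ 2) * (1 + u ^ 2) := by
    have e : (((r * x.1 - y.1) ^ 2 + (r * x.2 - y.2) ^ 2) / r +
      ((r⁻¹ * x.1 - y.1) ^ 2 + (r⁻¹ * x.2 - y.2) ^ 2) * r) / 2 =
      ((x.1 - y.1) ^ 2 + (x.2 - y.2) ^ 2) +
        (r - 1) ^ 2 / (2 * r) * (x.1 ^ 2 + x.2 ^ 2 + y.1 ^ 2 + y.2 ^ 2) := by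
      field_simp; ring
    have e1 : (r - 1) ^ 2 / (2 * r) * (x.1 ^ 2 + x.2 ^ 2 + y.1 ^ 2 + y.2 ^ 2) ≤
        (r - 1) ^ 2 * (4 * R ^ 2) := by
      gcongr
      · exact div_le_self (sq_nonneg _) (by linarith)
      · linarith
    have e2 : (r - 1) ^ 2 * (4 * R ^ 2) = ‖x - y‖ ^ 2 * u ^ 2 := by
      rw [hu, div_pow, mul_div_cancel₀ _ (by positivity), mul_pow, sq_abs]; ring
    have e3 : ‖x - y‖ ^ 2 * u ^ 2 ≤ ((x.1 - y.1) ^ 2 + (x.2 - y.2) ^ 2) * u ^ 2 := by gcongr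
    rw [e]
    linarith
  have key := two_log_sub_le (c := 4 * x.2 * y.2) (by positivity) hD
    (div_pos h₁ hr0) (mul_pos h₂ hr0) hm (sq_nonneg u)
  have key2 := log_one_add_sq_le hu0
  have hpi : 1 / (4 * π) ≤ 1 / 4 := by
    rw [div_le_div_iff₀ (by positivity) (by norm_num)]; nlinarith [Real.pi_gt_three]
  have hu32 : (2 * R * |r - 1|) ^ (3 / 2 : ℝ) * ‖x - y‖ ^ (-(3 / 2) : ℝ) =
      u ^ (3 / 2 : ℝ) := by
    rw [hu, Real.div_rpow (by positivity) (by positivity), Real.rpow_neg (by positivity),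
      ← div_eq_mul_inv]
  have hu00 : 0 ≤ u ^ (3 / 2 : ℝ) := by positivity
  rw [g₁, g₂, hu32]
  unfold G
  calc _ = 1 / (4 * π) * (2 * Real.log (1 + 4 * x.2 * y.2 /
        ((x.1 - y.1) ^ 2 + (x.2 - y.2) ^ 2)) - Real.log (1 + 4 * x.2 * y.2 /
        (((r * x.1 - y.1) ^ 2 + (r * x.2 - y.2) ^ 2) / r)) - Real.log (1 + 4 * x.2 * y.2 /
        (((r⁻¹ * x.1 - y.1) ^ 2 + (r⁻¹ * x.2 - y.2) ^ 2) * r))) := by ring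
    _ ≤ 1 / (4 * π) * (4 * u ^ (3 / 2 : ℝ)) := by gcongr; linarith
    _ ≤ 1 / 4 * (4 * u ^ (3 / 2 : ℝ)) := by gcongr
    _ = _ := by ring

lemma exists_two_patchPot_sub_le (hA : MeasurableSet A) (hAH : A ⊆ H) (hAv : volume A ≠ ⊤)
    {R : ℝ} (hAR : ∀ x ∈ A, ‖x‖ ≤ R) :
    ∃ C, ∀ r : ℝ, 1 / 2 ≤ r → ∀ x ∈ A,
      2 * patchPot A x - patchPot A (r • x) - patchPot A (r⁻¹ • x) ≤
        C * |r - 1| ^ (3 / 2 : ℝ) := by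
  set C := (∫ z in Metric.ball (0 : ℝ × ℝ) 1, ‖z‖ ^ (-(3 / 2) : ℝ)) + volume.real A
  refine ⟨(2 * R) ^ (3 / 2 : ℝ) * C, fun r hr x hx => ?_⟩
  have hR0 : 0 ≤ R := (norm_nonneg x).trans (hAR x hx)
  have hr0 : 0 < r := by linarith
  have i0 := integrableOn_green hA hAH hAv (hAH hx)
  have i1 := integrableOn_green hA hAH hAv (smul_mem_H hr0 (hAH hx))
  have i2 := integrableOn_green hA hAH hAv (smul_mem_H (inv_pos.2 hr0) (hAH hx))
  have i3 := integrableOn_riesz (α := 3 / 2) (by norm_num) (by norm_num) hA hAv x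
  have i4 : IntegrableOn (fun y => 2 * G x y - G (r • x) y) A := (i0.const_mul 2).sub i1
  have e : 2 * patchPot A x - patchPot A (r • x) - patchPot A (r⁻¹ • x) =
      ∫ y in A, (2 * G x y - G (r • x) y - G (r⁻¹ • x) y) := by
    rw [integral_sub i4 i2, integral_sub (i0.const_mul 2) i1, integral_const_mul]
    rfl
  rw [e]
  have ne_ae : ∀ z : ℝ × ℝ, ∀ᵐ y ∂volume.restrict A, y ≠ z := fun z =>
    ae_restrict_of_ae (Measure.ae_ne volume z)
  calc _ ≤ ∫ y in A, (2 * R * |r - 1|) ^ (3 / 2 : ℝ) * ‖x - y‖ ^ (-(3 / 2) : ℝ) := by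
        refine integral_mono_ae (i4.sub i2) (i3.const_mul _) ?_
        filter_upwards [ae_restrict_mem hA, ne_ae x, ne_ae (r • x), ne_ae (r⁻¹ • x)]
          with y hy n0 n1 n2
        exact two_green_sub_le (hAH hx) (hAH hy) (hAR x hx) (hAR y hy) hr n0 n1 n2
    _ ≤ (2 * R * |r - 1|) ^ (3 / 2 : ℝ) * C := by
        rw [integral_const_mul]
        gcongr
        exact setIntegral_riesz_le (by norm_num) (by norm_num) hA hAv x
    _ = _ := by
        rw [Real.mul_rpow (by positivity) (by positivity)]; ring

/-- The critical point condition for a function bounded below by a power larger than one. -/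
lemma eq_of_forall_scaling_nonneg {P a C : ℝ}
    (h : ∀ r : ℝ, 1 / 2 ≤ r → r ≤ 2 →
      0 ≤ (r ^ 2)⁻¹ * P - P + a * (r - 1) + C * |r - 1| ^ (3 / 2 : ℝ)) :
    a = 2 * P := by
  have hd : HasDerivAt (fun r : ℝ => (r ^ 2)⁻¹ * P - P + a * (r - 1) +
      C * |r - 1| ^ (3 / 2 : ℝ)) (-2 * P + a) 1 := by
    have d1 : HasDerivAt (fun r : ℝ => (r ^ 2)⁻¹) (-2) 1 := by
      exact ((hasDerivAt_pow 2 (1 : ℝ)).inv (by norm_num)).congr_deriv (by norm_num)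
    have d2 : HasDerivAt (fun r : ℝ => r - 1) 1 1 := (hasDerivAt_id 1).sub_const 1
    have d3 : HasDerivAt (fun r : ℝ => |r - 1| ^ (3 / 2 : ℝ)) 0 1 := by
      have d4 : HasDerivAt (fun s : ℝ => |s| ^ (3 / 2 : ℝ)) 0 ((fun r : ℝ => r - 1) 1) := by
        simpa using hasDerivAt_abs_rpow (0 : ℝ) (show (1 : ℝ) < 3 / 2 by norm_num)
      exact (d4.comp (h := fun r : ℝ => r - 1) 1 d2).congr_deriv (by norm_num)
    exact ((((d1.mul_const P).sub_const P).add (d2.const_mul a)).add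
      (d3.const_mul C)).congr_deriv (by ring)
  have hmin : IsLocalMin (fun r : ℝ => (r ^ 2)⁻¹ * P - P + a * (r - 1) +
      C * |r - 1| ^ (3 / 2 : ℝ)) 1 := by
    filter_upwards [Icc_mem_nhds (show (1 / 2 : ℝ) < 1 by norm_num)
      (show (1 : ℝ) < 2 by norm_num)] with r hr
    have := h r hr.1 hr.2
    simpa [Real.zero_rpow] using this
  have := hmin.hasDerivAt_eq_zero hd
  linarith

lemma integrableOn_patchPot_smul (hA : MeasurableSet A) (hAH : A ⊆ H) (hAv : volume A ≠ ⊤)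
    {R : ℝ} (hAR : ∀ x ∈ A, ‖x‖ ≤ R) {r : ℝ} (hr : 0 < r) :
    IntegrableOn (fun x => patchPot A (r • x)) A := by
  obtain ⟨C, hC0, hC⟩ := exists_patchPot_le hA hAH hAv
  refine IntegrableOn.of_bound hAv.lt_top
    ((measurable_patchPot A).comp (measurable_const_smul r)).aestronglyMeasurable
    (C * (r * R)) ?_
  filter_upwards [ae_restrict_mem hA] with x hx
  have hrx := smul_mem_H hr (hAH hx)
  rw [Real.norm_of_nonneg (patchPot_nonneg hA hAH hrx)]
  refine (hC _ hrx).trans ?_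
  simp only [Prod.smul_snd, smul_eq_mul]
  gcongr
  exact (le_abs_self _).trans ((abs_snd_le_norm x).trans (hAR x hx))

lemma setIntegral_patchPot_smul_inv (hA : MeasurableSet A) (hAH : A ⊆ H)
    (hAv : volume A ≠ ⊤) {R : ℝ} (hAR : ∀ x ∈ A, ‖x‖ ≤ R) {r : ℝ} (hr : 0 < r) :
    ∫ x in A, patchPot A (r⁻¹ • x) = ∫ x in A, patchPot A (r • x) := by
  have hm : Measurable (Function.uncurry fun x y : ℝ × ℝ => G (r • x) y) :=
    measurable_green.comp (f := fun p : (ℝ × ℝ) × (ℝ × ℝ) => (r • p.1, p.2)) (by fun_prop)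
  have : IsFiniteMeasure (volume.restrict A) := ⟨by simpa using hAv.lt_top⟩
  have hi : Integrable (Function.uncurry fun x y : ℝ × ℝ => G (r • x) y)
      ((volume.restrict A).prod (volume.restrict A)) := by
    rw [integrable_prod_iff hm.aestronglyMeasurable]
    simp only [Function.uncurry_apply_pair]
    constructor
    · filter_upwards [ae_restrict_mem hA] with x hx
      exact integrableOn_green hA hAH hAv (smul_mem_H hr (hAH hx))
    · have h : Integrable (fun x => patchPot A (r • x)) (volume.restrict A) :=
        integrableOn_patchPot_smul hA hAH hAv hAR hr
      refine h.congr ?_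
      filter_upwards [ae_restrict_mem hA] with x hx
      refine setIntegral_congr_fun hA fun y hy => ?_
      exact (Real.norm_of_nonneg (green_nonneg (smul_mem_H hr (hAH hx)) (hAH hy))).symm
  calc _ = ∫ x in A, ∫ y in A, G (r • y) x := by
        simp only [patchPot, green_smul_left hr]
    _ = _ := (integral_integral_swap hi).symm

/-- Pohozaev's identity for a bounded patch which is a superlevel set of its own relative
stream function. -/
lemma setIntegral_patchPot_eq (hA : MeasurableSet A) (hAH : A ⊆ H) (hAv : volume A ≠ ⊤)
    {R : ℝ} (hAR : ∀ x ∈ A, ‖x‖ ≤ R) {W γ : ℝ}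
    (hrep : ∀ᵐ x, x ∈ H → (x ∈ A ↔ 0 < patchPot A x - W * x.2 - γ)) :
    ∫ x in A, patchPot A x = 3 / 2 * W * (∫ x in A, x.2) + γ * volume.real A := by
  obtain ⟨C, hC⟩ := exists_two_patchPot_sub_le hA hAH hAv hAR
  have hsnd : IntegrableOn (fun x : ℝ × ℝ => x.2) A := by
    refine IntegrableOn.of_bound hAv.lt_top measurable_snd.aestronglyMeasurable R ?_
    filter_upwards [ae_restrict_mem hA] with x hx
    exact (abs_snd_le_norm x).trans (hAR x hx)
  have hcst : IntegrableOn (fun _ : ℝ × ℝ => γ) A := integrableOn_const hAv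
  set ψ : ℝ × ℝ → ℝ := fun x => patchPot A x - W * x.2 - γ with hψ
  have hpot : ∀ r : ℝ, 0 < r → IntegrableOn (fun x => patchPot A (r • x)) A := fun r hr =>
    integrableOn_patchPot_smul hA hAH hAv hAR hr
  have hpot1 : IntegrableOn (fun x => patchPot A x) A := by simpa using hpot 1 one_pos
  have hψsmul : ∀ r : ℝ, 0 < r → IntegrableOn (fun x => ψ (r • x)) A := fun r hr => by
    have := ((hpot r hr).sub (hsnd.const_mul (W * r))).sub hcst
    refine this.congr (ae_of_all _ fun x => ?_)
    simp [hψ, mul_assoc]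
  have hψint : ∀ r : ℝ, 0 < r → ∫ x in A, ψ (r • x) =
      (∫ x in A, patchPot A (r • x)) - W * r * (∫ x in A, x.2) - γ * volume.real A := by
    intro r hr
    have hi : IntegrableOn (fun x => patchPot A (r • x) - W * r * x.2) A :=
      (hpot r hr).sub (hsnd.const_mul (W * r))
    rw [← integral_const_mul, ← integral_sub (hpot r hr) (hsnd.const_mul (W * r)), mul_comm γ,
      ← smul_eq_mul (volume.real A), ← setIntegral_const, ← integral_sub hi hcst]
    simp [hψ, mul_assoc]
  have hψ1 : IntegrableOn ψ A := by simpa using hψsmul 1 one_pos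
  have hpos : ∀ᵐ x ∂volume.restrict H, max (ψ x) 0 = A.indicator ψ x := by
    filter_upwards [ae_restrict_of_ae hrep, ae_restrict_mem (measurableSet_lt
      measurable_const measurable_snd)] with x hx hxH
    by_cases hxA : x ∈ A
    · rw [indicator_of_mem hxA, max_eq_left ((hx hxH).1 hxA).le]
    · rw [indicator_of_notMem hxA, max_eq_right (not_lt.1 fun h => hxA ((hx hxH).2 h))]
  have hind : IntegrableOn (A.indicator ψ) H := ((integrable_indicator_iff hA).2 hψ1).integrableOn
  have hposi : IntegrableOn (fun x => max (ψ x) 0) H :=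
    hind.congr (hpos.mono fun _ h => h.symm)
  have hbath : ∀ r : ℝ, 0 < r → ∫ x in A, ψ (r • x) ≤ (r ^ 2)⁻¹ * ∫ x in A, ψ x := by
    intro r hr
    have hsub : r • A ⊆ H := by
      rintro _ ⟨x, hx, rfl⟩
      exact smul_mem_H hr (hAH hx)
    have hrA : IntegrableOn ψ (r • A) := by
      have h := hψsmul r hr
      rw [← integrable_indicator_iff hA] at h
      rw [← integrable_indicator_iff (hA.const_smul₀ r),
        ← integrable_comp_smul_iff volume _ hr.ne']
      refine h.congr (ae_of_all _ fun x => ?_)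
      by_cases hx : x ∈ A <;> simp [hx, smul_mem_smul_set_iff₀ hr.ne']
    rw [Measure.setIntegral_comp_smul_of_pos volume ψ A hr, smul_eq_mul]
    have hfr : Module.finrank ℝ (ℝ × ℝ) = 2 := by simp
    rw [hfr]
    refine mul_le_mul_of_nonneg_left ?_ (by positivity)
    calc ∫ x in r • A, ψ x ≤ ∫ x in r • A, max (ψ x) 0 :=
          integral_mono hrA (hposi.mono_set hsub) fun x => le_max_left _ _
      _ ≤ ∫ x in H, max (ψ x) 0 :=
          setIntegral_mono_set hposi (ae_of_all _ fun x => le_max_right _ _)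
            (ae_of_all _ hsub)
      _ = ∫ x in H, A.indicator ψ x := integral_congr_ae hpos
      _ = ∫ x in A, ψ x := by
          rw [setIntegral_indicator hA, inter_eq_self_of_subset_right hAH]
  have hlow : ∀ r : ℝ, 1 / 2 ≤ r → ∫ x in A, patchPot A x ≤
      (∫ x in A, patchPot A (r • x)) + C / 2 * volume.real A * |r - 1| ^ (3 / 2 : ℝ) := by
    intro r hr
    have hr0 : 0 < r := by linarith
    have i1 : IntegrableOn (fun x => 2 * patchPot A x - patchPot A (r • x)) A :=
      (hpot1.const_mul 2).sub (hpot r hr0)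
    have := setIntegral_mono_on (i1.sub (hpot r⁻¹ (inv_pos.2 hr0)))
      (integrableOn_const (C := C * |r - 1| ^ (3 / 2 : ℝ)) hAv) hA (hC r hr)
    simp only [Pi.sub_apply] at this
    rw [integral_sub i1 (hpot r⁻¹ (inv_pos.2 hr0)), integral_sub (hpot1.const_mul 2) (hpot r hr0),
      setIntegral_patchPot_smul_inv hA hAH hAv hAR hr0, setIntegral_const, integral_const_mul,
      smul_eq_mul] at this
    linarith
  have h1 := hψint 1 one_pos
  simp only [one_smul, mul_one] at h1
  have hcrit : W * (∫ x in A, x.2) = 2 * ∫ x in A, ψ x := by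
    refine eq_of_forall_scaling_nonneg (C := C / 2 * volume.real A) fun r hr hr2 => ?_
    have hr0 : 0 < r := by linarith
    have a1 := hbath r hr0
    rw [hψint r hr0] at a1
    have a2 := hlow r hr
    linarith
  linarith

lemma setIntegral_congr_indicator (hA : MeasurableSet A) (hAH : A ⊆ H) {ω : ℝ × ℝ → ℝ}
    (hω : ∀ᵐ x ∂volume.restrict H, ω x = A.indicator (fun _ => (1 : ℝ)) x)
    (f : ℝ × ℝ → ℝ) : ∫ x in H, f x * ω x = ∫ x in A, f x := by
  rw [← inter_eq_self_of_subset_right hAH, ← setIntegral_indicator hA]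
  refine integral_congr_ae ?_
  filter_upwards [hω] with x hx
  by_cases h : x ∈ A <;> simp [hx, h]

lemma gpot_eq_patchPot (hA : MeasurableSet A) (hAH : A ⊆ H) {ω : ℝ × ℝ → ℝ}
    (hω : ∀ᵐ x ∂volume.restrict H, ω x = A.indicator (fun _ => (1 : ℝ)) x) (x : ℝ × ℝ) :
    Gpot ω x = patchPot A x :=
  setIntegral_congr_indicator hA hAH hω _

lemma energy_eq_patchPot (hA : MeasurableSet A) (hAH : A ⊆ H) {ω : ℝ × ℝ → ℝ}
    (hω : ∀ᵐ x ∂volume.restrict H, ω x = A.indicator (fun _ => (1 : ℝ)) x) :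
    energy ω = 1 / 2 * ∫ x in A, patchPot A x := by
  unfold energy
  rw [← setIntegral_congr_indicator hA hAH hω]
  congr 2 with x
  rw [← gpot_eq_patchPot hA hAH hω, Gpot, ← integral_mul_const]
  congr 1 with y
  ring

lemma norm1_eq_volume (hA : MeasurableSet A) (hAH : A ⊆ H) {ω : ℝ × ℝ → ℝ}
    (hω : ∀ᵐ x ∂volume.restrict H, ω x = A.indicator (fun _ => (1 : ℝ)) x) :
    norm1 ω = volume.real A := by
  have h := setIntegral_congr_indicator hA hAH hω (fun _ => 1)
  simp only [one_mul, setIntegral_const, smul_eq_mul, mul_one] at h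
  rw [← h, norm1]
  refine integral_congr_ae ?_
  filter_upwards [hω] with x hx
  rw [hx, abs_of_nonneg (indicator_nonneg (fun _ _ => zero_le_one) x)]

end Patch

/-- Pohožaev-type identity `I_M = (3/4) W M + (1/2) γ ‖ω‖₁` for
maximizers. -/
theorem pohozaev_identity (M : ℝ) (hM : 0 < M)
    (ω : ℝ × ℝ → ℝ) (hω : memS M ω) (W γ : ℝ) (hW : 0 < W) (hγ : 0 ≤ γ)
    (hrep : ∀ᵐ x ∂volume.restrict H,
      ω x = Set.indicator {y ∈ H | 0 < Gpot ω y - W * y.2 - γ} (fun _ => (1 : ℝ)) x) :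
    energy ω = (3 / 4) * W * M + (1 / 2) * γ * norm1 ω := by
  obtain ⟨⟨-, A, hAH, hA, hωA, hAM, hA1⟩, -⟩ := hω
  have hAv : volume A ≠ ⊤ := ne_top_of_le_ne_top ENNReal.one_ne_top hA1
  have hHm : MeasurableSet H := measurableSet_lt measurable_const measurable_snd
  have hrepA : ∀ᵐ x, x ∈ H → (x ∈ A ↔ 0 < Gpot ω x - W * x.2 - γ) := by
    have h1 := (ae_restrict_iff' hHm).1 hωA
    have h2 := (ae_restrict_iff' hHm).1 hrep
    filter_upwards [h1, h2] with x hx1 hx2 hxH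
    have e := (hx1 hxH).symm.trans (hx2 hxH)
    constructor
    · intro hxA
      by_contra hn
      rw [indicator_of_mem hxA, indicator_of_notMem fun h => hn h.2] at e
      exact one_ne_zero e
    · intro hxψ
      by_contra hn
      rw [indicator_of_notMem hn, indicator_of_mem (mem_sep hxH hxψ)] at e
      exact zero_ne_one e
  obtain ⟨R, hR⟩ := exists_patchPot_le_of_norm_gt hA hAH hAv hW
  set B := A ∩ Metric.closedBall 0 R with hB
  have hBA : B =ᵐ[volume] A := by
    filter_upwards [hrepA] with x hx
    refine propext ⟨fun h => h.1, fun h => ⟨h, ?_⟩⟩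
    rw [mem_closedBall_zero_iff]
    by_contra hxR
    have h1 := hR x (hAH h) (not_le.1 hxR)
    have h2 := (hx (hAH h)).1 h
    rw [gpot_eq_patchPot hA hAH hωA] at h2
    linarith
  have hBm : MeasurableSet B := hA.inter Metric.isClosed_closedBall.measurableSet
  have hBH : B ⊆ H := inter_subset_left.trans hAH
  have hmem : ∀ᵐ x, x ∈ B ↔ x ∈ A := hBA.mem_iff
  have hωB : ∀ᵐ x ∂volume.restrict H, ω x = B.indicator (fun _ => (1 : ℝ)) x := by
    filter_upwards [hωA, ae_restrict_of_ae hmem] with x hx hxB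
    rw [hx]
    by_cases h : x ∈ A
    · rw [indicator_of_mem h, indicator_of_mem (hxB.2 h)]
    · rw [indicator_of_notMem h, indicator_of_notMem (mt hxB.1 h)]
  have hBv : volume B ≠ ⊤ := measure_ne_top_of_subset inter_subset_left hAv
  have hrepB : ∀ᵐ x, x ∈ H → (x ∈ B ↔ 0 < patchPot B x - W * x.2 - γ) := by
    filter_upwards [hrepA, hmem] with x hx hxB hxH
    rw [hxB, hx hxH, gpot_eq_patchPot hBm hBH hωB]
  have key := setIntegral_patchPot_eq hBm hBH hBv
    (fun x hx => mem_closedBall_zero_iff.1 hx.2) hrepB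
  rw [setIntegral_congr_set (f := fun x : ℝ × ℝ => x.2) hBA, hAM] at key
  rw [energy_eq_patchPot hBm hBH hωB, norm1_eq_volume hBm hBH hωB, key]
  ring
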